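/- arXiv:1908.06652 — 9 statements merged into one kernel-verified Lean document; each statement's English description precedes it below -/
import Mathlib

section
/- Let m ≥ 1, let x1 ∈ GF(2)^m have Hamming weight w', and let t be an integer with 0 ≤ t ≤ m − w'. Then the number of vectors x2 ∈ GF(2)^m such that the concatenation (x1 + x2, x2) has Hamming weight w' + 2t equals 2^{w'} · C(m − w', t), where C(·,·) is the binomial coefficient. -/
/-- The weight of a concatenation `(x + y, y)` of binary vectors: each coordinate in the support of
`x` contributes `1`, and each coordinate in the support of `y` only contributes `2`. -/
theorem hammingNorm_append_add_self {m : ℕ} (x y : Fin m → ZMod 2) :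
    hammingNorm (Fin.append (x + y) y) =
      hammingNorm x + 2 * (Finset.univ.filter fun i => x i = 0 ∧ y i ≠ 0).card := by
  simp only [hammingNorm, Finset.card_filter, Fin.sum_univ_add, Fin.append_left, Fin.append_right,
    Finset.mul_sum, ← Finset.sum_add_distrib, Pi.add_apply]
  have h : ∀ a b : ZMod 2, ((if a + b ≠ 0 then 1 else 0) + if b ≠ 0 then 1 else 0) =
      (if a ≠ 0 then 1 else 0) + 2 * if a = 0 ∧ b ≠ 0 then 1 else 0 := by decide
  exact Finset.sum_congr rfl fun i _ => by convert h (x i) (y i)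

/-- Binary vectors whose support meets the complement of `A` in exactly `t` points. -/
theorem card_filter_support_sdiff {ι : Type*} [Fintype ι] [DecidableEq ι] (A : Finset ι) (t : ℕ) :
    (Finset.univ.filter fun y : ι → ZMod 2 =>
      (Finset.univ.filter fun i => i ∉ A ∧ y i ≠ 0).card = t).card =
      2 ^ A.card * (Fintype.card ι - A.card).choose t := by
  rw [← Finset.card_compl, ← Finset.card_powerset, ← Finset.card_powersetCard,
    ← Finset.card_product]
  refine Finset.card_bij'
    (fun y _ => (Finset.univ.filter fun i => i ∈ A ∧ y i ≠ 0,
      Finset.univ.filter fun i => i ∉ A ∧ y i ≠ 0))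
    (fun p _ i => if i ∈ p.1 ∪ p.2 then 1 else 0) ?_ ?_ ?_ ?_
  · intro y hy
    simp only [Finset.mem_filter, Finset.mem_univ, true_and] at hy
    simp only [Finset.mem_product, Finset.mem_powerset, Finset.mem_powersetCard]
    exact ⟨fun i hi => by simp_all, fun i hi => by simp_all, hy⟩
  · rintro ⟨P, Q⟩ hp
    simp only [Finset.mem_product, Finset.mem_powerset, Finset.mem_powersetCard] at hp
    obtain ⟨hP, hQ, hc⟩ := hp
    simp only [Finset.mem_filter, Finset.mem_univ, true_and, ← hc]
    congr 1
    ext i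
    have hPi := @hP i
    have hQi := @hQ i
    simp at hQi ⊢
    tauto
  · intro y _
    ext i
    have h : ∀ a : ZMod 2, (if a ≠ 0 then (1 : ZMod 2) else 0) = a := by decide
    rw [← h (y i)]
    by_cases hi : i ∈ A <;> simp [hi]
  · rintro ⟨P, Q⟩ hp
    simp only [Finset.mem_product, Finset.mem_powerset, Finset.mem_powersetCard] at hp
    obtain ⟨hP, hQ, -⟩ := hp
    ext i <;>
    · have hPi := @hP i
      have hQi := @hQ i
      simp at hQi ⊢
      tauto


/-- For `m ≥ 1`, `x1 : GF(2)^m` of Hamming weight `w'`, and `0 ≤ t ≤ m - w'`,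
the number of `x2 : GF(2)^m` with `w((x1 + x2, x2)) = w' + 2t` equals `2^{w'} · C(m - w', t)`. -/
theorem stmt_1 {m : ℕ} (hm : 1 ≤ m) (x1 : Fin m → ZMod 2) (w' t : ℕ)
    (hw : hammingNorm x1 = w') (ht : t ≤ m - w') :
    {x2 : Fin m → ZMod 2 | hammingNorm (Fin.append (x1 + x2) x2) = w' + 2 * t}.ncard =
      2 ^ w' * (m - w').choose t := by
  have h := card_filter_support_sdiff (Finset.univ.filter fun i => x1 i ≠ 0) t
  rw [Fintype.card_fin, show (Finset.univ.filter fun i => x1 i ≠ 0).card = w' from hw] at h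
  rw [← h, ← Set.ncard_coe_finset]
  congr 1
  ext y
  simp [hammingNorm_append_add_self, hw]
end

section
/- Let n ≥ 1, N = 2^n, and 0 ≤ i < N/2. Then the map (x1, x2) ↦ (x1 + x2, x2) is a bijection from C^{(n-1)}(0^i, 1) × GF(2)^{N/2} onto C^{(n)}(0^i, 1), where C^{(n-1)}(0^i, 1) is the one-coset of level n−1 formed from the rows of G_{N/2}. -/
/-- Arıkan's 2×2 polarization kernel over GF(2). -/
def G2 : Matrix (Fin 2) (Fin 2) (ZMod 2) := !![1, 0; 1, 1]

/-- `G n` is the `n`-th Kronecker power `G₂^{⊗n}`, an `2^n × 2^n` matrix over GF(2).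
The index `a * 2^n + b` corresponds to the pair `(a, b)`, so the most significant bit
comes from the leftmost Kronecker factor. -/
def G : (n : ℕ) → Matrix (Fin (2 ^ n)) (Fin (2 ^ n)) (ZMod 2)
  | 0 => 1
  | n + 1 =>
    Matrix.reindex (finProdFinEquiv.trans (finCongr (by ring)))
      (finProdFinEquiv.trans (finCongr (by ring)))
      (Matrix.kroneckerMap (· * ·) G2 (G n))

/-- The `i`-th row `g_i` of `G n`. -/
def row (n : ℕ) (i : Fin (2 ^ n)) : Fin (2 ^ n) → ZMod 2 := G n i

/-- `bit i j` is the `j`-th bit in the binary representation of `i`. -/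
def bit (i j : ℕ) : ℕ := i / 2 ^ j % 2

/-- The span of the rows `g_j` of `G n` with `j > i`. -/
def spanAbove (n : ℕ) (i : ℕ) : Submodule (ZMod 2) (Fin (2 ^ n) → ZMod 2) :=
  Submodule.span (ZMod 2) {v | ∃ j : Fin (2 ^ n), i < (j : ℕ) ∧ v = row n j}

/-- The one-coset `C^{(n)}(0^i, 1) = g_i + ⟨g_{i+1}, …, g_{N-1}⟩`. -/
def oneCoset (n : ℕ) (i : Fin (2 ^ n)) : Set (Fin (2 ^ n) → ZMod 2) :=
  {x | ∃ v ∈ spanAbove n (i : ℕ), x = row n i + v}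

/-- `S n i w` is the number of vectors of Hamming weight `w` in `C^{(n)}(0^i, 1)`. -/
noncomputable def S (n : ℕ) (i : Fin (2 ^ n)) (w : ℕ) : ℕ :=
  {x ∈ oneCoset n i | hammingNorm x = w}.ncard

/-- Concatenation of two vectors of length `2^n` into a vector of length `2^(n+1)`. -/
def app2 {n : ℕ} (a b : Fin (2 ^ n) → ZMod 2) : Fin (2 ^ (n + 1)) → ZMod 2 :=
  fun k => Fin.append a b (finCongr (by ring : 2 ^ (n + 1) = 2 ^ n + 2 ^ n) k)

theorem two_pow_succ_eq (n : ℕ) : 2 ^ n + 2 ^ n = 2 ^ (n + 1) := by ring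

/-- The index `b` of the first half of `Fin (2 ^ (n + 1))`. -/
def lowIndex {n : ℕ} (b : Fin (2 ^ n)) : Fin (2 ^ (n + 1)) :=
  Fin.cast (two_pow_succ_eq n) (Fin.castAdd (2 ^ n) b)

/-- The index `2 ^ n + b` of the second half of `Fin (2 ^ (n + 1))`. -/
def highIndex {n : ℕ} (b : Fin (2 ^ n)) : Fin (2 ^ (n + 1)) :=
  Fin.cast (two_pow_succ_eq n) (Fin.natAdd (2 ^ n) b)

theorem lowIndex_or_highIndex {n : ℕ} (k : Fin (2 ^ (n + 1))) :
    (∃ b : Fin (2 ^ n), k = lowIndex b) ∨ ∃ b : Fin (2 ^ n), k = highIndex b := by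
  have hk : (k : ℕ) < 2 ^ n + 2 ^ n := (two_pow_succ_eq n).symm ▸ k.isLt
  by_cases h : (k : ℕ) < 2 ^ n
  · exact Or.inl ⟨⟨k, h⟩, Fin.ext rfl⟩
  · refine Or.inr ⟨⟨k - 2 ^ n, by omega⟩, Fin.ext ?_⟩
    change (k : ℕ) = 2 ^ n + (k - 2 ^ n)
    omega

theorem app2_lowIndex {n : ℕ} (a b : Fin (2 ^ n) → ZMod 2) (k : Fin (2 ^ n)) :
    app2 a b (lowIndex k) = a k :=
  Fin.append_left a b k

theorem app2_highIndex {n : ℕ} (a b : Fin (2 ^ n) → ZMod 2) (k : Fin (2 ^ n)) :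
    app2 a b (highIndex k) = b k :=
  Fin.append_right a b k

/-- The linear map `(x₁, x₂) ↦ (x₁ + x₂, x₂)`, with concatenation as the outer pairing. -/
def plotkin (n : ℕ) :
    ((Fin (2 ^ n) → ZMod 2) × (Fin (2 ^ n) → ZMod 2)) →ₗ[ZMod 2]
      (Fin (2 ^ (n + 1)) → ZMod 2) where
  toFun p := app2 (p.1 + p.2) p.2
  map_add' p q := by
    funext k
    obtain ⟨b, rfl⟩ | ⟨b, rfl⟩ := lowIndex_or_highIndex k
    · simp only [Pi.add_apply, app2_lowIndex, Prod.fst_add, Prod.snd_add]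
      ring
    · simp only [Pi.add_apply, app2_highIndex, Prod.snd_add]
  map_smul' c p := by
    funext k
    obtain ⟨b, rfl⟩ | ⟨b, rfl⟩ := lowIndex_or_highIndex k
    · simp [app2_lowIndex, mul_add]
    · simp [app2_highIndex]

theorem plotkin_bijective (n : ℕ) : Function.Bijective (plotkin n) := by
  constructor
  · rintro ⟨a, b⟩ ⟨c, d⟩ h
    have h' : app2 (a + b) b = app2 (c + d) d := h
    have hs : b = d := funext fun k => by
      simpa only [app2_highIndex] using congrFun h' (highIndex k)
    subst hs
    have hf : a + b = c + b := funext fun k => by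
      simpa only [app2_lowIndex] using congrFun h' (lowIndex k)
    rw [add_right_cancel hf]
  · intro x
    refine ⟨(fun k => x (lowIndex k) - x (highIndex k), fun k => x (highIndex k)), ?_⟩
    change app2 _ _ = x
    funext k
    obtain ⟨b, rfl⟩ | ⟨b, rfl⟩ := lowIndex_or_highIndex k
    · simp [app2_lowIndex]
    · simp [app2_highIndex]

theorem G_succ_apply (n : ℕ) (a c : Fin 2) (b d : Fin (2 ^ n)) (k l : Fin (2 ^ (n + 1)))
    (hk : (k : ℕ) = b + 2 ^ n * a) (hl : (l : ℕ) = d + 2 ^ n * c) :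
    G (n + 1) k l = G2 a c * G n b d := by
  have e : 2 * 2 ^ n = 2 ^ (n + 1) := by ring
  obtain rfl : k = finProdFinEquiv.trans (finCongr e) (a, b) := Fin.ext hk
  obtain rfl : l = finProdFinEquiv.trans (finCongr e) (c, d) := Fin.ext hl
  simp only [G, Matrix.reindex_apply, Matrix.submatrix_apply, Equiv.symm_apply_apply,
    Matrix.kroneckerMap_apply]

theorem row_lowIndex {n : ℕ} (b : Fin (2 ^ n)) :
    row (n + 1) (lowIndex b) = plotkin n (row n b, 0) := by
  change _ = app2 (row n b + 0) 0
  funext k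
  obtain ⟨d, rfl⟩ | ⟨d, rfl⟩ := lowIndex_or_highIndex k
  · rw [app2_lowIndex, row, G_succ_apply n 0 0 b d _ _ (by simp [lowIndex]) (by simp [lowIndex])]
    simp [G2, row]
  · rw [app2_highIndex, row, G_succ_apply n 0 1 b d _ _ (by simp [lowIndex])
      (by simp [highIndex])]
    simp [G2]

theorem row_highIndex {n : ℕ} (b : Fin (2 ^ n)) :
    row (n + 1) (highIndex b) = plotkin n (0, row n b) := by
  change _ = app2 (0 + row n b) (row n b)
  funext k
  obtain ⟨d, rfl⟩ | ⟨d, rfl⟩ := lowIndex_or_highIndex k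
  · rw [app2_lowIndex, row, G_succ_apply n 1 0 b d _ _ (by simp [highIndex])
      (by simp [lowIndex])]
    simp [G2, row]
  · rw [app2_highIndex, row, G_succ_apply n 1 1 b d _ _ (by simp [highIndex])
      (by simp [highIndex])]
    simp [G2, row]

theorem span_range_row (n : ℕ) : Submodule.span (ZMod 2) (Set.range (row n)) = ⊤ := by
  induction n with
  | zero =>
    rw [eq_top_iff]
    intro x _
    have hx : x = x 0 • row 0 0 := by
      funext k
      obtain rfl : k = 0 := Subsingleton.elim (α := Fin 1) _ _
      simp [row, G]
    rw [hx]
    exact Submodule.smul_mem _ _ (Submodule.subset_span ⟨0, rfl⟩)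
  | succ n ih =>
    have hset : Set.range (row (n + 1)) = plotkin n ''
        (LinearMap.inl (ZMod 2) _ _ '' Set.range (row n) ∪
          LinearMap.inr (ZMod 2) _ _ '' Set.range (row n)) := by
      ext v
      constructor
      · rintro ⟨k, rfl⟩
        obtain ⟨b, rfl⟩ | ⟨b, rfl⟩ := lowIndex_or_highIndex k
        · exact ⟨_, Or.inl ⟨_, ⟨b, rfl⟩, rfl⟩, (row_lowIndex b).symm⟩
        · exact ⟨_, Or.inr ⟨_, ⟨b, rfl⟩, rfl⟩, (row_highIndex b).symm⟩
      · rintro ⟨_, ⟨_, ⟨b, rfl⟩, rfl⟩ | ⟨_, ⟨b, rfl⟩, rfl⟩, rfl⟩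
        · exact ⟨_, row_lowIndex b⟩
        · exact ⟨_, row_highIndex b⟩
    rw [hset, Submodule.span_image, LinearMap.span_inl_union_inr, ih, Submodule.prod_top,
      Submodule.map_top, LinearMap.range_eq_top]
    exact (plotkin_bijective n).2

theorem spanAbove_succ (n i : ℕ) (hi : i < 2 ^ n) :
    spanAbove (n + 1) i = ((spanAbove n i).prod ⊤).map (plotkin n) := by
  rw [spanAbove, spanAbove, ← span_range_row n, ← LinearMap.span_inl_union_inr,
    ← Submodule.span_image]
  congr 1
  ext v
  constructor
  · rintro ⟨k, hk, rfl⟩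
    obtain ⟨b, rfl⟩ | ⟨b, rfl⟩ := lowIndex_or_highIndex k
    · exact ⟨_, Or.inl ⟨_, ⟨b, hk, rfl⟩, rfl⟩, (row_lowIndex b).symm⟩
    · exact ⟨_, Or.inr ⟨_, ⟨b, rfl⟩, rfl⟩, (row_highIndex b).symm⟩
  · rintro ⟨_, ⟨_, ⟨b, hb, rfl⟩, rfl⟩ | ⟨_, ⟨b, rfl⟩, rfl⟩, rfl⟩
    · exact ⟨_, hb, (row_lowIndex b).symm⟩
    · exact ⟨highIndex b, by simp only [highIndex, Fin.val_cast, Fin.val_natAdd]; omega,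
        (row_highIndex b).symm⟩

/-- For `n ≥ 1`, `N = 2^n` (here written with `n+1` so `N/2 = 2^n`), and
`0 ≤ i < N/2`, the map `(x1, x2) ↦ (x1 + x2, x2)` is a bijection from
`C^{(n-1)}(0^i, 1) × GF(2)^{N/2}` onto `C^{(n)}(0^i, 1)`. -/
theorem stmt_2 (n : ℕ) (i : ℕ) (hi : i < 2 ^ n) :
    Set.BijOn
      (fun p : (Fin (2 ^ n) → ZMod 2) × (Fin (2 ^ n) → ZMod 2) => app2 (p.1 + p.2) p.2)
      ((oneCoset n ⟨i, hi⟩) ×ˢ (Set.univ : Set (Fin (2 ^ n) → ZMod 2)))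
      (oneCoset (n + 1) ⟨i, by rw [pow_succ]; omega⟩) := by
  have hrow : row (n + 1) ⟨i, by rw [pow_succ]; omega⟩ = plotkin n (row n ⟨i, hi⟩, 0) :=
    row_lowIndex ⟨i, hi⟩
  change Set.BijOn (plotkin n) _ _
  refine ⟨?_, (plotkin_bijective n).1.injOn, ?_⟩
  · rintro ⟨x, y⟩ ⟨⟨v, hv, hx⟩, -⟩
    refine ⟨plotkin n (v, y), ?_, ?_⟩
    · rw [spanAbove_succ n i hi]
      exact ⟨(v, y), ⟨hv, trivial⟩, rfl⟩
    · rw [hrow, ← map_add, Prod.mk_add_mk, zero_add, ← hx]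
  · rintro x ⟨w, hw, rfl⟩
    rw [spanAbove_succ n i hi] at hw
    obtain ⟨⟨v, y⟩, ⟨hv, -⟩, rfl⟩ := hw
    refine ⟨(row n ⟨i, hi⟩ + v, y), ⟨⟨v, hv, rfl⟩, trivial⟩, ?_⟩
    rw [hrow, ← map_add, Prod.mk_add_mk, zero_add]
end

section
/- Let n ≥ 1, N = 2^n, and N/2 ≤ i < N. Then every element of C^{(n)}(0^i, 1) equals the repetition (x2, x2) for a unique x2 ∈ C^{(n-1)}(0^{i−N/2}, 1), where C^{(n-1)}(0^{i−N/2}, 1) is the one-coset of level n−1 formed from the rows of G_{N/2}. Consequently S^{(n)}_{i,w} = 0 for every odd w, and S^{(n)}_{i,2w} = S^{(n-1)}_{i−N/2,w} for every 0 ≤ w ≤ N/2. -/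
/-- The index `a * 2 ^ n + b` of `G (n + 1)` that corresponds to the pair `(a, b)`. -/
def kronIndex (n : ℕ) : Fin 2 × Fin (2 ^ n) ≃ Fin (2 ^ (n + 1)) :=
  finProdFinEquiv.trans (finCongr (by ring))

theorem kronIndex_val (n : ℕ) (a : Fin 2) (b : Fin (2 ^ n)) :
    (kronIndex n (a, b) : ℕ) = b + 2 ^ n * a := by
  simp [kronIndex]

theorem row_kronIndex (n : ℕ) (a c : Fin 2) (b d : Fin (2 ^ n)) :
    row (n + 1) (kronIndex n (a, b)) (kronIndex n (c, d)) = G2 a c * row n b d := by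
  simp only [row, G, Matrix.reindex_apply, Matrix.submatrix_apply]
  erw [Equiv.symm_apply_apply (kronIndex n), Equiv.symm_apply_apply (kronIndex n)]
  rfl

theorem app2_kronIndex {n : ℕ} (x y : Fin (2 ^ n) → ZMod 2) (c : Fin 2) (d : Fin (2 ^ n)) :
    app2 x y (kronIndex n (c, d)) = if c = 0 then x d else y d := by
  unfold app2
  fin_cases c
  · have h : finCongr (by ring : 2 ^ (n + 1) = 2 ^ n + 2 ^ n) (kronIndex n (0, d)) =
        Fin.castAdd (2 ^ n) d := by
      ext; simp [kronIndex_val]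
    simpa using (congrArg (Fin.append x y) h).trans (Fin.append_left x y d)
  · have h : finCongr (by ring : 2 ^ (n + 1) = 2 ^ n + 2 ^ n) (kronIndex n (1, d)) =
        Fin.natAdd (2 ^ n) d := by
      ext; simp [kronIndex_val]
    simpa using (congrArg (Fin.append x y) h).trans (Fin.append_right x y d)

/-- The repetition map `x ↦ (x, x)`. -/
def repeatMap (n : ℕ) : (Fin (2 ^ n) → ZMod 2) →ₗ[ZMod 2] (Fin (2 ^ (n + 1)) → ZMod 2) :=
  LinearMap.funLeft (ZMod 2) (ZMod 2) fun k => ((kronIndex n).symm k).2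

theorem repeatMap_kronIndex {n : ℕ} (x : Fin (2 ^ n) → ZMod 2) (p : Fin 2 × Fin (2 ^ n)) :
    repeatMap n x (kronIndex n p) = x p.2 := by
  simp [repeatMap, LinearMap.funLeft_apply]

theorem repeatMap_eq_app2 {n : ℕ} (x : Fin (2 ^ n) → ZMod 2) : repeatMap n x = app2 x x := by
  ext k
  obtain ⟨⟨c, d⟩, rfl⟩ := (kronIndex n).surjective k
  rw [repeatMap_kronIndex, app2_kronIndex, ite_self]

theorem repeatMap_injective (n : ℕ) : Function.Injective (repeatMap n) := by
  intro x y h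
  ext d
  simpa only [repeatMap_kronIndex] using congrFun h (kronIndex n (0, d))

theorem hammingNorm_repeatMap {n : ℕ} (x : Fin (2 ^ n) → ZMod 2) :
    hammingNorm (repeatMap n x) = 2 * hammingNorm x := by
  simp only [hammingNorm, Finset.card_filter]
  rw [← (kronIndex n).sum_comp]
  simp only [repeatMap_kronIndex, Fintype.sum_prod_type, Fin.sum_univ_two, two_mul]

theorem row_eq_repeatMap {n : ℕ} (k : Fin (2 ^ (n + 1))) (j : Fin (2 ^ n))
    (h : (k : ℕ) = 2 ^ n + j) : row (n + 1) k = repeatMap n (row n j) := by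
  have hk : k = kronIndex n (1, j) := by
    ext; simp [kronIndex_val, h, add_comm]
  subst hk
  ext l
  obtain ⟨⟨c, d⟩, rfl⟩ := (kronIndex n).surjective l
  rw [row_kronIndex, repeatMap_kronIndex]
  fin_cases c <;> simp [G2]

theorem spanAbove_eq_map (n i : ℕ) :
    spanAbove (n + 1) (2 ^ n + i) = (spanAbove n i).map (repeatMap n) := by
  rw [spanAbove, spanAbove, Submodule.map_span]
  congr 1
  ext v
  constructor
  · rintro ⟨k, hk, rfl⟩
    have hlt : (k : ℕ) - 2 ^ n < 2 ^ n := by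
      have := k.isLt
      have := pow_succ 2 n
      omega
    refine ⟨_, ⟨⟨k - 2 ^ n, hlt⟩, by simp only; omega, rfl⟩, ?_⟩
    exact (row_eq_repeatMap k _ (by simp only; omega)).symm
  · rintro ⟨_, ⟨j, hj, rfl⟩, rfl⟩
    have hlt : 2 ^ n + (j : ℕ) < 2 ^ (n + 1) := by
      have := j.isLt
      rw [pow_succ]
      omega
    exact ⟨⟨2 ^ n + j, hlt⟩, by simp only; omega, (row_eq_repeatMap _ j rfl).symm⟩

theorem oneCoset_eq_image {n : ℕ} (k : Fin (2 ^ (n + 1))) (j : Fin (2 ^ n))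
    (h : (k : ℕ) = 2 ^ n + j) : oneCoset (n + 1) k = repeatMap n '' oneCoset n j := by
  ext x
  simp only [oneCoset, Set.mem_ofPred_eq, Set.mem_image, h, spanAbove_eq_map, Submodule.mem_map,
    row_eq_repeatMap k j h]
  constructor
  · rintro ⟨_, ⟨v, hv, rfl⟩, rfl⟩
    exact ⟨_, ⟨v, hv, rfl⟩, map_add _ _ _⟩
  · rintro ⟨_, ⟨v, hv, rfl⟩, rfl⟩
    exact ⟨_, ⟨v, hv, rfl⟩, map_add _ _ _⟩

/-- For `n ≥ 1`, `N = 2^n` (written with `n+1`), and `N/2 ≤ i < N`, every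
element of `C^{(n)}(0^i, 1)` is `(x2, x2)` for a unique `x2 ∈ C^{(n-1)}(0^{i-N/2}, 1)`;
consequently `S^{(n)}_{i,w} = 0` for odd `w` and `S^{(n)}_{i,2w} = S^{(n-1)}_{i-N/2,w}`
for `0 ≤ w ≤ N/2`. -/
theorem stmt_3 (n : ℕ) (i : ℕ) (hi1 : 2 ^ n ≤ i) (hi : i < 2 ^ (n + 1)) :
    (∀ x ∈ oneCoset (n + 1) ⟨i, hi⟩,
      ∃! x2 : Fin (2 ^ n) → ZMod 2,
        x2 ∈ oneCoset n ⟨i - 2 ^ n, by rw [pow_succ] at hi; omega⟩ ∧ x = app2 x2 x2) ∧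
    (∀ w, Odd w → S (n + 1) ⟨i, hi⟩ w = 0) ∧
    (∀ w ≤ 2 ^ n,
      S (n + 1) ⟨i, hi⟩ (2 * w) = S n ⟨i - 2 ^ n, by rw [pow_succ] at hi; omega⟩ w) := by
  obtain ⟨j, hj⟩ : ∃ j : Fin (2 ^ n), j = ⟨i - 2 ^ n, by rw [pow_succ] at hi; omega⟩ := ⟨_, rfl⟩
  rw [← hj]
  have hC := oneCoset_eq_image ⟨i, hi⟩ j (by simp only [hj]; omega)
  refine ⟨?_, ?_, ?_⟩
  · rw [hC]
    rintro _ ⟨x, hx, rfl⟩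
    refine ⟨x, ⟨hx, repeatMap_eq_app2 x⟩, ?_⟩
    rintro y ⟨-, hy⟩
    exact repeatMap_injective n ((repeatMap_eq_app2 y).trans hy.symm)
  · intro w hw
    rw [S, hC, Set.ncard_eq_zero]
    refine Set.eq_empty_of_forall_notMem ?_
    rintro _ ⟨⟨x, -, rfl⟩, hx⟩
    rw [hammingNorm_repeatMap] at hx
    exact Nat.not_even_iff_odd.mpr hw (hx ▸ even_two_mul _)
  · intro w _
    rw [S, S, hC, ← Set.ncard_image_of_injective _ (repeatMap_injective n)]
    congr 1
    ext y
    constructor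
    · rintro ⟨⟨x, hx, rfl⟩, hw⟩
      rw [hammingNorm_repeatMap] at hw
      exact ⟨x, ⟨hx, by omega⟩, rfl⟩
    · rintro ⟨x, ⟨hx, hw⟩, rfl⟩
      exact ⟨⟨x, hx, rfl⟩, by rw [hammingNorm_repeatMap, hw]⟩
end

section
/- For N = 2^n and any 0 ≤ i < N, the Hamming weight of the i-th row of G_N satisfies w(g_i) = 2^{p_{n-1}(i)}, where p_{n-1}(i) is the number of ones in the binary representation of i. -/
theorem hammingNorm_comp_equiv {ι κ R : Type*} [Fintype ι] [Fintype κ] [Zero R] [DecidableEq R]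
    (e : ι ≃ κ) (f : κ → R) : hammingNorm (fun i => f (e i)) = hammingNorm f := by
  unfold hammingNorm
  exact Finset.card_equiv e (by simp)

theorem hammingNorm_mul_prod {ι κ R : Type*} [Fintype ι] [Fintype κ] [MulZeroClass R]
    [NoZeroDivisors R] [DecidableEq R] (u : ι → R) (v : κ → R) :
    hammingNorm (fun p : ι × κ => u p.1 * v p.2) = hammingNorm u * hammingNorm v := by
  unfold hammingNorm
  rw [← Finset.card_product]
  congr 1
  ext p
  simp

theorem hammingNorm_G2 (a : Fin 2) : hammingNorm (G2 a) = 2 ^ (a : ℕ) := by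
  revert a
  decide

theorem bit_mod_two_pow {i s n : ℕ} (hs : s < n) : bit (i % 2 ^ n) s = bit i s := by
  unfold bit
  have h := Nat.testBit_mod_two_pow i n s
  simp only [hs, decide_true, Bool.true_and, Nat.testBit_eq_decide_div_mod_eq,
    decide_eq_decide] at h
  omega

theorem hammingNorm_row_succ (n : ℕ) (i : ℕ) (hi : i < 2 ^ (n + 1)) :
    hammingNorm (row (n + 1) ⟨i, hi⟩) =
      2 ^ (i / 2 ^ n) * hammingNorm (row n ⟨i % 2 ^ n, Nat.mod_lt _ (by positivity)⟩) := by
  let e : Fin 2 × Fin (2 ^ n) ≃ Fin (2 ^ (n + 1)) :=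
    finProdFinEquiv.trans (finCongr (by ring))
  exact (hammingNorm_comp_equiv e.symm fun p =>
      G2 (e.symm ⟨i, hi⟩).1 p.1 * G n (e.symm ⟨i, hi⟩).2 p.2).trans <|
    (hammingNorm_mul_prod (G2 (e.symm ⟨i, hi⟩).1) (G n (e.symm ⟨i, hi⟩).2)).trans <|
      congrArg (· * _) (hammingNorm_G2 _)

/-- For `N = 2^n` and `0 ≤ i < N`, the Hamming weight of the `i`-th row of
`G_N` is `2^{p_{n-1}(i)}`, where `p_{n-1}(i) = Σ_{s=0}^{n-1} b_s(i)` is the number of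
ones in the binary representation of `i`. -/
theorem stmt_5 (n : ℕ) (i : ℕ) (hi : i < 2 ^ n) :
    hammingNorm (row n ⟨i, hi⟩) = 2 ^ (∑ s ∈ Finset.range n, bit i s) := by
  induction n generalizing i with
  | zero =>
    obtain rfl : i = 0 := by simpa using hi
    decide +revert
  | succ n ih =>
    have hlt : i / 2 ^ n < 2 := Nat.div_lt_of_lt_mul (by rwa [← pow_succ])
    have htop : bit i n = i / 2 ^ n := Nat.mod_eq_of_lt hlt
    rw [hammingNorm_row_succ, ih, Finset.sum_range_succ, htop, pow_add, mul_comm,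
      Finset.sum_congr rfl fun s hs => bit_mod_two_pow (Finset.mem_range.mp hs)]
end

section
/- Let N = 2^n and 0 ≤ i < N. Every vector x in the coset C^{(n)}(0^i, 1) satisfies w(x) ≥ w(g_i) = 2^{p_{n-1}(i)}, and this bound is attained (e.g., by g_i itself); equivalently, S^{(n)}_{i,w} = 0 for all w < 2^{p_{n-1}(i)} and S^{(n)}_{i, 2^{p_{n-1}(i)}} > 0. -/
/-- The index bijection underlying the recursive definition of `G (n + 1)`. -/
def pairEquiv (n : ℕ) : Fin 2 × Fin (2 ^ n) ≃ Fin (2 ^ (n + 1)) :=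
  finProdFinEquiv.trans (finCongr (by ring))

/-- The half of a vector of length `2 ^ (n + 1)` selected by the most significant index bit. -/
def half (n : ℕ) (c : Fin 2) :
    (Fin (2 ^ (n + 1)) → ZMod 2) →ₗ[ZMod 2] (Fin (2 ^ n) → ZMod 2) :=
  LinearMap.funLeft (ZMod 2) (ZMod 2) fun d => pairEquiv n (c, d)

lemma pairEquiv_val (n : ℕ) (a : Fin 2) (b : Fin (2 ^ n)) :
    (pairEquiv n (a, b) : ℕ) = b + 2 ^ n * a := rfl

lemma half_row (n : ℕ) (a c : Fin 2) (b : Fin (2 ^ n)) :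
    half n c (row (n + 1) (pairEquiv n (a, b))) = G2 a c • row n b := by
  ext d
  change Matrix.reindex (pairEquiv n) (pairEquiv n) (Matrix.kroneckerMap (· * ·) G2 (G n))
    (pairEquiv n (a, b)) (pairEquiv n (c, d)) = _
  simp [row]

lemma hammingNorm_eq_add_half (n : ℕ) (x : Fin (2 ^ (n + 1)) → ZMod 2) :
    hammingNorm x = hammingNorm (half n 0 x) + hammingNorm (half n 1 x) := by
  have h {m : ℕ} (y : Fin m → ZMod 2) : hammingNorm y = ∑ k, if y k ≠ 0 then 1 else 0 :=
    Finset.card_filter _ _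
  rw [h, h, h, ← (pairEquiv n).sum_comp, Fintype.sum_prod_type, Fin.sum_univ_two]
  rfl

lemma sum_bit_pairEquiv (n : ℕ) (a : Fin 2) (b : Fin (2 ^ n)) :
    ∑ s ∈ Finset.range (n + 1), bit (pairEquiv n (a, b)) s =
      ∑ s ∈ Finset.range n, bit b s + a := by
  rw [Finset.sum_range_succ, pairEquiv_val]
  congr 1
  · refine Finset.sum_congr rfl fun s hs => ?_
    obtain ⟨k, rfl⟩ := Nat.exists_eq_add_of_lt (Finset.mem_range.mp hs)
    have h : (b : ℕ) + 2 ^ (s + k + 1) * a = b + 2 ^ s * (2 * (2 ^ k * a)) := by ring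
    rw [bit, bit, h, Nat.add_mul_div_left _ _ (by positivity), Nat.add_mul_mod_self_left]
  · rw [bit, Nat.add_mul_div_left _ _ (by positivity), Nat.div_eq_of_lt b.isLt, zero_add,
      Nat.mod_eq_of_lt a.isLt]

lemma hammingNorm_row (n : ℕ) (i : Fin (2 ^ n)) :
    hammingNorm (row n i) = 2 ^ (∑ s ∈ Finset.range n, bit i s) := by
  induction n with
  | zero =>
    have : row 0 i = fun _ => 1 := by
      ext d
      rw [show d = i from Subsingleton.elim (α := Fin 1) d i]
      simp [row, G]
    simp [this, hammingNorm]
  | succ n ih =>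
    obtain ⟨⟨a, b⟩, rfl⟩ := (pairEquiv n).surjective i
    rw [hammingNorm_eq_add_half, sum_bit_pairEquiv, half_row, half_row, pow_add, ← ih b]
    fin_cases a <;> simp [G2, mul_two]

lemma row_mem_spanAbove {n i : ℕ} {j : Fin (2 ^ n)} (hij : i < j) : row n j ∈ spanAbove n i :=
  Submodule.subset_span ⟨j, hij, rfl⟩

lemma half_sub_half_mem_spanAbove (n : ℕ) (b : Fin (2 ^ n))
    {v : Fin (2 ^ (n + 1)) → ZMod 2} (hv : v ∈ spanAbove (n + 1) (pairEquiv n (0, b))) :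
    half n 0 v - half n 1 v ∈ spanAbove n b := by
  suffices h : spanAbove (n + 1) (pairEquiv n (0, b)) ≤
      (spanAbove n b).comap (half n 0 - half n 1) from h hv
  refine Submodule.span_le.mpr ?_
  rintro _ ⟨j, hj, rfl⟩
  obtain ⟨⟨a', b'⟩, rfl⟩ := (pairEquiv n).surjective j
  simp only [SetLike.mem_coe, Submodule.mem_comap, LinearMap.sub_apply, half_row]
  fin_cases a'
  · simpa [G2] using row_mem_spanAbove (by simpa [pairEquiv_val] using hj)
  · simp [G2]

lemma halves_of_mem_spanAbove (n : ℕ) (b : Fin (2 ^ n))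
    {v : Fin (2 ^ (n + 1)) → ZMod 2} (hv : v ∈ spanAbove (n + 1) (pairEquiv n (1, b))) :
    half n 0 v ∈ spanAbove n b ∧ half n 1 v = half n 0 v := by
  suffices h : spanAbove (n + 1) (pairEquiv n (1, b)) ≤
      (spanAbove n b).comap (half n 0) ⊓ LinearMap.eqLocus (half n 1) (half n 0) from h hv
  refine Submodule.span_le.mpr ?_
  rintro _ ⟨j, hj, rfl⟩
  obtain ⟨⟨a', b'⟩, rfl⟩ := (pairEquiv n).surjective j
  simp only [SetLike.mem_coe, Submodule.mem_inf, Submodule.mem_comap, LinearMap.mem_eqLocus,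
    half_row]
  fin_cases a'
  · have := b'.isLt
    simp [pairEquiv_val] at hj
    omega
  · simpa [G2] using row_mem_spanAbove (by simpa [pairEquiv_val] using hj)

lemma row_mem_oneCoset (n : ℕ) (i : Fin (2 ^ n)) : row n i ∈ oneCoset n i :=
  ⟨0, zero_mem _, (add_zero _).symm⟩

lemma hammingNorm_sub_le {ι : Type*} [Fintype ι] {β : Type*} [AddCommGroup β] [DecidableEq β]
    (x y : ι → β) : hammingNorm (x - y) ≤ hammingNorm x + hammingNorm y := by
  rw [sub_eq_neg_add, ← hammingDist_eq_hammingNorm, add_comm, ← hammingDist_zero_right y,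
    ← hammingDist_zero_left]
  exact hammingDist_triangle _ _ _

lemma two_pow_sum_bit_le_hammingNorm (n : ℕ) (i : Fin (2 ^ n)) {x : Fin (2 ^ n) → ZMod 2}
    (hx : x ∈ oneCoset n i) : 2 ^ (∑ s ∈ Finset.range n, bit i s) ≤ hammingNorm x := by
  induction n with
  | zero =>
    obtain ⟨v, hv, rfl⟩ := hx
    have hspan : spanAbove 0 i = ⊥ := by
      refine Submodule.span_eq_bot.mpr ?_
      rintro _ ⟨j, hj, -⟩
      rw [show j = i from Subsingleton.elim (α := Fin 1) j i] at hj
      exact absurd hj (lt_irrefl _)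
    rw [hspan, Submodule.mem_bot] at hv
    rw [hv, add_zero, hammingNorm_row]
  | succ n ih =>
    obtain ⟨v, hv, rfl⟩ := hx
    obtain ⟨⟨a, b⟩, rfl⟩ := (pairEquiv n).surjective i
    rw [hammingNorm_eq_add_half, sum_bit_pairEquiv]
    obtain rfl | rfl : a = 0 ∨ a = 1 := by fin_cases a <;> simp
    · have h := ih b ⟨_, half_sub_half_mem_spanAbove n b hv, rfl⟩
      refine h.trans ?_
      have hd : row n b + (half n 0 v - half n 1 v) =
          half n 0 (row (n + 1) (pairEquiv n (0, b)) + v) -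
            half n 1 (row (n + 1) (pairEquiv n (0, b)) + v) := by
        simp only [map_add, half_row]
        simp [G2, add_sub_assoc]
      rw [hd]
      exact hammingNorm_sub_le _ _
    · obtain ⟨hmem, heq⟩ := halves_of_mem_spanAbove n b hv
      have h := ih b ⟨_, hmem, rfl⟩
      have hc : ∀ c, half n c (row (n + 1) (pairEquiv n (1, b)) + v) =
          row n b + half n 0 v := by
        intro c
        rw [map_add, half_row]
        fin_cases c <;> simp [G2, heq]
      rw [hc, hc, pow_add, Fin.val_one, pow_one, mul_two]
      exact add_le_add h h

/-- For `N = 2^n` and `0 ≤ i < N`, every `x ∈ C^{(n)}(0^i, 1)` satisfies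
`w(x) ≥ w(g_i) = 2^{p_{n-1}(i)}`, the bound is attained by `g_i` itself; equivalently
`S^{(n)}_{i,w} = 0` for `w < 2^{p_{n-1}(i)}` and `S^{(n)}_{i,2^{p_{n-1}(i)}} > 0`. -/
theorem stmt_7 (n : ℕ) (i : ℕ) (hi : i < 2 ^ n) :
    (∀ x ∈ oneCoset n ⟨i, hi⟩, 2 ^ (∑ s ∈ Finset.range n, bit i s) ≤ hammingNorm x) ∧
    row n ⟨i, hi⟩ ∈ oneCoset n ⟨i, hi⟩ ∧
    hammingNorm (row n ⟨i, hi⟩) = 2 ^ (∑ s ∈ Finset.range n, bit i s) ∧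
    (∀ w < 2 ^ (∑ s ∈ Finset.range n, bit i s), S n ⟨i, hi⟩ w = 0) ∧
    0 < S n ⟨i, hi⟩ (2 ^ (∑ s ∈ Finset.range n, bit i s)) := by
  refine ⟨fun x hx => two_pow_sum_bit_le_hammingNorm n ⟨i, hi⟩ hx, row_mem_oneCoset n _,
    hammingNorm_row n ⟨i, hi⟩, fun w hw => ?_, ?_⟩
  · rw [S, Set.ncard_eq_zero (Set.toFinite _), Set.eq_empty_iff_forall_notMem]
    rintro x ⟨hx, rfl⟩
    exact (two_pow_sum_bit_le_hammingNorm n ⟨i, hi⟩ hx).not_gt hw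
  · rw [S, Set.ncard_pos (Set.toFinite _)]
    exact ⟨_, row_mem_oneCoset n _, hammingNorm_row n ⟨i, hi⟩⟩
end

section
/- Let n ≥ 1 and let a, a' be integers in [0, 2^n) for which there exist indices u < w < n such that b_k(a) = b_k(a') for all k ∉ {u, w}, b_u(a) = b_w(a') = 1, and b_w(a) = b_u(a') = 0. Then Σ_{k=0}^{n-1} (1 − b_k(a)) 2^{p_k(a)} > Σ_{k=0}^{n-1} (1 − b_k(a')) 2^{p_k(a')}. -/
/-- Moving a one of a bit sequence from position `u` to position `w` changes its prefix sums
only between `u` and `w`. -/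
lemma prefix_sum_add_ite {f g : ℕ → ℕ} {u w : ℕ} (huw : u ≠ w)
    (hfg : ∀ k, k ≠ u → k ≠ w → f k = g k)
    (hfu : f u = 1) (hgw : g w = 1) (hfw : f w = 0) (hgu : g u = 0) (m : ℕ) :
    ∑ s ∈ Finset.range m, f s + (if w < m then 1 else 0) =
      ∑ s ∈ Finset.range m, g s + (if u < m then 1 else 0) := by
  induction m with
  | zero => simp
  | succ m ih =>
    rw [Finset.sum_range_succ, Finset.sum_range_succ]
    rcases eq_or_ne m u with rfl | hu
    · split_ifs at ih ⊢ <;> omega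
    rcases eq_or_ne m w with rfl | hw
    · split_ifs at ih ⊢ <;> omega
    have := hfg m hu hw
    split_ifs at ih ⊢ <;> omega

/-- Let `n ≥ 1` and `a, a' < 2^n` be such that for some `u < w < n` the
binary representations of `a` and `a'` agree outside positions `u` and `w`, while
`b_u(a) = b_w(a') = 1` and `b_w(a) = b_u(a') = 0`. Then
`Σ_{k=0}^{n-1} (1 - b_k(a)) 2^{p_k(a)} > Σ_{k=0}^{n-1} (1 - b_k(a')) 2^{p_k(a')}`,
where `p_k(x) = Σ_{s=0}^{k} b_s(x)`. -/
theorem stmt_11 (n : ℕ) (hn : 1 ≤ n) (a a' : ℕ) (ha : a < 2 ^ n) (ha' : a' < 2 ^ n)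
    (u w : ℕ) (huw : u < w) (hw : w < n)
    (hbits : ∀ k, k ≠ u → k ≠ w → bit a k = bit a' k)
    (h1 : bit a u = 1) (h2 : bit a' w = 1) (h3 : bit a w = 0) (h4 : bit a' u = 0) :
    ∑ k ∈ Finset.range n, (1 - bit a k) * 2 ^ (∑ s ∈ Finset.range (k + 1), bit a s) >
      ∑ k ∈ Finset.range n, (1 - bit a' k) * 2 ^ (∑ s ∈ Finset.range (k + 1), bit a' s) := by
  have hsum := prefix_sum_add_ite huw.ne hbits h1 h2 h3 h4
  have hu_mem : u ∈ (Finset.range n).erase w := by simp; omega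
  have hw_mem : w ∈ Finset.range n := Finset.mem_range.2 hw
  have hrest : ∀ k ∈ ((Finset.range n).erase w).erase u,
      (1 - bit a' k) * 2 ^ (∑ s ∈ Finset.range (k + 1), bit a' s) ≤
        (1 - bit a k) * 2 ^ (∑ s ∈ Finset.range (k + 1), bit a s) := by
    intro k hk
    simp only [Finset.mem_erase] at hk
    rw [hbits k hk.1 hk.2.1]
    refine Nat.mul_le_mul_left _ (Nat.pow_le_pow_right two_pos ?_)
    have := hsum (k + 1)
    split_ifs at this <;> omega
  have hlt : 2 ^ (∑ s ∈ Finset.range (u + 1), bit a' s) <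
      2 ^ (∑ s ∈ Finset.range (w + 1), bit a s) := by
    refine Nat.pow_lt_pow_right one_lt_two ?_
    have hmono : ∑ s ∈ Finset.range (u + 1), bit a' s ≤ ∑ s ∈ Finset.range w, bit a' s :=
      Finset.sum_le_sum_of_subset (Finset.range_subset_range.2 huw)
    have hw_succ := Finset.sum_range_succ (bit a') w
    have := hsum (w + 1)
    split_ifs at this <;> omega
  have hle := Finset.sum_le_sum hrest
  rw [gt_iff_lt, ← Finset.add_sum_erase _ _ hw_mem, ← Finset.add_sum_erase _ _ hu_mem,
    ← Finset.add_sum_erase (Finset.range n) _ hw_mem, ← Finset.add_sum_erase _ _ hu_mem,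
    h1, h2, h3, h4]
  omega
end

section
/- Let N = 2^n and 0 ≤ i < j < N. Then every vector x in the coset C^{(n)}(i, j) := g_i + g_j + span{g_{j+1}, …, g_{N-1}} satisfies w(x) ≥ w(g_i + g_j). -/
/-- The coset `C^{(n)}(i, j) = g_i + g_j + ⟨g_{j+1}, …, g_{N-1}⟩`. -/
def twoCoset (n : ℕ) (i j : Fin (2 ^ n)) : Set (Fin (2 ^ n) → ZMod 2) :=
  {x | ∃ v ∈ spanAbove n (j : ℕ), x = row n i + row n j + v}

/-- The index of `Fin (2 ^ (n + 1))` with leading bit `0` and remaining bits `a`. -/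
def lowIdx {n : ℕ} (a : Fin (2 ^ n)) : Fin (2 ^ (n + 1)) :=
  ⟨a, by have := a.isLt; rw [pow_succ]; omega⟩

/-- The index of `Fin (2 ^ (n + 1))` with leading bit `1` and remaining bits `a`. -/
def highIdx {n : ℕ} (a : Fin (2 ^ n)) : Fin (2 ^ (n + 1)) :=
  ⟨2 ^ n + a, by have := a.isLt; rw [pow_succ]; omega⟩

lemma eq_lowIdx_or_eq_highIdx {n : ℕ} (k : Fin (2 ^ (n + 1))) :
    (∃ a, k = lowIdx a) ∨ ∃ a, k = highIdx a := by
  have hk := k.isLt.trans_eq (pow_succ 2 n)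
  by_cases h : (k : ℕ) < 2 ^ n
  · exact .inl ⟨⟨k, h⟩, rfl⟩
  · refine .inr ⟨⟨k - 2 ^ n, by omega⟩, Fin.ext ?_⟩
    simp only [highIdx]
    omega

section app2

variable {n : ℕ} (a b c d : Fin (2 ^ n) → ZMod 2)

@[simp]
lemma app2_lowIdx (k : Fin (2 ^ n)) : app2 a b (lowIdx k) = a k :=
  Fin.append_left a b k

@[simp]
lemma app2_highIdx (k : Fin (2 ^ n)) : app2 a b (highIdx k) = b k :=
  Fin.append_right a b k

lemma funext_idx {x y : Fin (2 ^ (n + 1)) → ZMod 2} (hl : ∀ k, x (lowIdx k) = y (lowIdx k))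
    (hh : ∀ k, x (highIdx k) = y (highIdx k)) : x = y := by
  funext k
  rcases eq_lowIdx_or_eq_highIdx k with ⟨a, rfl⟩ | ⟨a, rfl⟩
  exacts [hl a, hh a]

lemma app2_add : app2 a b + app2 c d = app2 (a + c) (b + d) :=
  funext_idx (by simp) (by simp)

lemma app2_mul : app2 a b * app2 c d = app2 (a * c) (b * d) :=
  funext_idx (by simp) (by simp)

lemma app2_sub : app2 a b - app2 c d = app2 (a - c) (b - d) :=
  funext_idx (by simp) (by simp)

lemma smul_app2 (r : ZMod 2) : r • app2 a b = app2 (r • a) (r • b) :=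
  funext_idx (by simp) (by simp)

lemma app2_zero_zero : app2 (0 : Fin (2 ^ n) → ZMod 2) 0 = 0 :=
  funext_idx (by simp) (by simp)

lemma app2_one_one : app2 (1 : Fin (2 ^ n) → ZMod 2) 1 = 1 :=
  funext_idx (by simp) (by simp)

lemma hammingNorm_eq_sum {m : ℕ} (x : Fin m → ZMod 2) :
    hammingNorm x = ∑ k, if x k ≠ 0 then 1 else 0 :=
  Finset.card_filter _ _

lemma hammingNorm_app2 : hammingNorm (app2 a b) = hammingNorm a + hammingNorm b := by
  have e : 2 ^ (n + 1) = 2 ^ n + 2 ^ n := by ring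
  simp only [hammingNorm_eq_sum]
  rw [← Equiv.sum_comp (finCongr e.symm), Fin.sum_univ_add]
  have hl (k : Fin (2 ^ n)) : finCongr e.symm (Fin.castAdd (2 ^ n) k) = lowIdx k := rfl
  have hh (k : Fin (2 ^ n)) : finCongr e.symm (Fin.natAdd (2 ^ n) k) = highIdx k := rfl
  simp only [hl, hh, app2_lowIdx, app2_highIdx]

end app2

lemma row_lowIdx {n : ℕ} (a : Fin (2 ^ n)) : row (n + 1) (lowIdx a) = app2 (row n a) 0 := by
  have e : 2 * 2 ^ n = 2 ^ (n + 1) := by ring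
  have hl (k : Fin (2 ^ n)) : lowIdx k = (finProdFinEquiv.trans (finCongr e)) (0, k) :=
    Fin.ext (by simp [lowIdx])
  have hh (k : Fin (2 ^ n)) : highIdx k = (finProdFinEquiv.trans (finCongr e)) (1, k) :=
    Fin.ext (by simp [highIdx, add_comm])
  refine funext_idx (fun k => ?_) (fun k => ?_)
  · rw [app2_lowIdx, row, G, Matrix.reindex_apply, Matrix.submatrix_apply, hl, hl,
      Equiv.symm_apply_apply, Equiv.symm_apply_apply]
    simp [G2, row]
  · rw [app2_highIdx, row, G, Matrix.reindex_apply, Matrix.submatrix_apply, hl, hh,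
      Equiv.symm_apply_apply, Equiv.symm_apply_apply]
    simp [G2]

lemma row_highIdx {n : ℕ} (a : Fin (2 ^ n)) :
    row (n + 1) (highIdx a) = app2 (row n a) (row n a) := by
  have e : 2 * 2 ^ n = 2 ^ (n + 1) := by ring
  have hl (k : Fin (2 ^ n)) : lowIdx k = (finProdFinEquiv.trans (finCongr e)) (0, k) :=
    Fin.ext (by simp [lowIdx])
  have hh (k : Fin (2 ^ n)) : highIdx k = (finProdFinEquiv.trans (finCongr e)) (1, k) :=
    Fin.ext (by simp [highIdx, add_comm])
  refine funext_idx (fun k => ?_) (fun k => ?_)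
  · rw [app2_lowIdx, row, G, Matrix.reindex_apply, Matrix.submatrix_apply, hl, hh,
      Equiv.symm_apply_apply, Equiv.symm_apply_apply]
    simp [G2, row]
  · rw [app2_highIdx, row, G, Matrix.reindex_apply, Matrix.submatrix_apply, hh, hh,
      Equiv.symm_apply_apply, Equiv.symm_apply_apply]
    simp [G2, row]

lemma row_mem_spanAbove_s13 {n k : ℕ} {a : Fin (2 ^ n)} (h : k < a) : row n a ∈ spanAbove n k :=
  Submodule.subset_span ⟨a, h, rfl⟩

lemma exists_app2_of_mem_spanAbove_highIdx {n : ℕ} {b : Fin (2 ^ n)}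
    {v : Fin (2 ^ (n + 1)) → ZMod 2} (hv : v ∈ spanAbove (n + 1) (highIdx b : ℕ)) :
    ∃ u ∈ spanAbove n b, v = app2 u u := by
  induction hv using Submodule.span_induction with
  | mem x hx =>
    obtain ⟨j, hj, rfl⟩ := hx
    rcases eq_lowIdx_or_eq_highIdx j with ⟨a, rfl⟩ | ⟨a, rfl⟩
    · have := a.isLt
      simp only [lowIdx, highIdx] at hj
      omega
    · exact ⟨row n a, row_mem_spanAbove_s13 (by simpa [highIdx] using hj), row_highIdx a⟩
  | zero => exact ⟨0, zero_mem _, app2_zero_zero.symm⟩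
  | add x y _ _ hx hy =>
    obtain ⟨u, hu, rfl⟩ := hx
    obtain ⟨w, hw, rfl⟩ := hy
    exact ⟨u + w, add_mem hu hw, app2_add ..⟩
  | smul r x _ hx =>
    obtain ⟨u, hu, rfl⟩ := hx
    exact ⟨r • u, Submodule.smul_mem _ r hu, smul_app2 ..⟩

lemma exists_app2_of_mem_spanAbove_lowIdx {n : ℕ} {b : Fin (2 ^ n)}
    {v : Fin (2 ^ (n + 1)) → ZMod 2} (hv : v ∈ spanAbove (n + 1) (lowIdx b : ℕ)) :
    ∃ u ∈ spanAbove n b, ∃ w, v = app2 (u + w) w := by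
  induction hv using Submodule.span_induction with
  | mem x hx =>
    obtain ⟨j, hj, rfl⟩ := hx
    rcases eq_lowIdx_or_eq_highIdx j with ⟨a, rfl⟩ | ⟨a, rfl⟩
    · exact ⟨row n a, row_mem_spanAbove_s13 hj, 0, by rw [row_lowIdx, add_zero]⟩
    · exact ⟨0, zero_mem _, row n a, by rw [row_highIdx, zero_add]⟩
  | zero => exact ⟨0, zero_mem _, 0, by rw [add_zero, app2_zero_zero]⟩
  | add x y _ _ hx hy =>
    obtain ⟨u, hu, w, rfl⟩ := hx
    obtain ⟨u', hu', w', rfl⟩ := hy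
    exact ⟨u + u', add_mem hu hu', w + w', by rw [app2_add, add_add_add_comm]⟩
  | smul r x _ hx =>
    obtain ⟨u, hu, w, rfl⟩ := hx
    exact ⟨r • u, Submodule.smul_mem _ r hu, r • w, by rw [smul_app2, smul_add]⟩

/-- `IsUpMask m` says that `m` is the indicator of an upper set of the Boolean lattice of
binary expansions of the coordinates. -/
inductive IsUpMask : {n : ℕ} → (Fin (2 ^ n) → ZMod 2) → Prop
  | zero (m : Fin (2 ^ 0) → ZMod 2) : IsUpMask m
  | succ {n : ℕ} {a b : Fin (2 ^ n) → ZMod 2} (ha : IsUpMask a) (hb : IsUpMask b)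
      (hab : a * b = a) : IsUpMask (app2 a b)

lemma isUpMask_one : ∀ n : ℕ, IsUpMask (1 : Fin (2 ^ n) → ZMod 2)
  | 0 => .zero _
  | n + 1 => by
    rw [← app2_one_one]
    exact .succ (isUpMask_one n) (isUpMask_one n) (mul_one _)

lemma isUpMask_one_sub_row : ∀ {n : ℕ} (i : Fin (2 ^ n)), IsUpMask (1 - row n i)
  | 0, _ => .zero _
  | n + 1, i => by
    rw [← app2_one_one]
    rcases eq_lowIdx_or_eq_highIdx i with ⟨a, rfl⟩ | ⟨a, rfl⟩
    · rw [row_lowIdx, app2_sub, sub_zero]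
      exact .succ (isUpMask_one_sub_row a) (isUpMask_one n) (mul_one _)
    · rw [row_highIdx, app2_sub]
      refine .succ (isUpMask_one_sub_row a) (isUpMask_one_sub_row a) (funext fun k => ?_)
      have key : ∀ x : ZMod 2, x * x = x := by decide
      exact key _

lemma hammingNorm_mul_le_add {n : ℕ} {a b : Fin n → ZMod 2} (hab : a * b = a)
    (u v : Fin n → ZMod 2) :
    hammingNorm (a * u) ≤ hammingNorm (a * (u + v)) + hammingNorm (b * v) := by
  simp only [hammingNorm_eq_sum, ← Finset.sum_add_distrib]
  refine Finset.sum_le_sum fun k _ => ?_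
  have key : ∀ a b u v : ZMod 2, a * b = a → (if a * u ≠ 0 then 1 else 0) ≤
      (if a * (u + v) ≠ 0 then 1 else 0) + (if b * v ≠ 0 then 1 else 0) := by decide
  exact key _ _ _ _ (congrFun hab k)

lemma hammingNorm_add_add_hammingNorm {n : ℕ} (g y : Fin n → ZMod 2) :
    hammingNorm (g + y) + hammingNorm y = 2 * hammingNorm ((1 - g) * y) + hammingNorm g := by
  simp only [hammingNorm_eq_sum, Finset.mul_sum, ← Finset.sum_add_distrib]
  refine Finset.sum_congr rfl fun k _ => ?_
  have key : ∀ g y : ZMod 2, (if g + y ≠ 0 then 1 else 0) + (if y ≠ 0 then 1 else 0) =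
      2 * (if (1 - g) * y ≠ 0 then 1 else 0) + (if g ≠ 0 then 1 else 0) := by decide
  exact key _ _

/-- Within the one-coset of `g_j`, the row `g_j` has minimum weight on every upper set of
coordinates. -/
lemma hammingNorm_mul_row_le {n : ℕ} {m : Fin (2 ^ n) → ZMod 2} (hm : IsUpMask m)
    (j : Fin (2 ^ n)) {v : Fin (2 ^ n) → ZMod 2} (hv : v ∈ spanAbove n j) :
    hammingNorm (m * row n j) ≤ hammingNorm (m * (row n j + v)) := by
  induction hm with
  | zero m =>
    have h : spanAbove 0 (j : ℕ) = ⊥ := by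
      refine Submodule.span_eq_bot.2 ?_
      rintro _ ⟨k, hk, -⟩
      have := k.isLt
      omega
    rw [h, Submodule.mem_bot] at hv
    rw [hv, add_zero]
  | succ ha hb hab iha ihb =>
    rcases eq_lowIdx_or_eq_highIdx j with ⟨j, rfl⟩ | ⟨j, rfl⟩
    · obtain ⟨u, hu, w, rfl⟩ := exists_app2_of_mem_spanAbove_lowIdx hv
      rw [row_lowIdx, app2_add, app2_mul, app2_mul, hammingNorm_app2, hammingNorm_app2,
        mul_zero, hammingNorm_zero, zero_add, add_zero, ← add_assoc]
      exact (iha j hu).trans (hammingNorm_mul_le_add hab _ _)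
    · obtain ⟨u, hu, rfl⟩ := exists_app2_of_mem_spanAbove_highIdx hv
      rw [row_highIdx, app2_add, app2_mul, app2_mul, hammingNorm_app2, hammingNorm_app2]
      exact add_le_add (iha j hu) (ihb j hu)

lemma hammingNorm_row_add_row_le : ∀ {n : ℕ} {i j : Fin (2 ^ n)}, i < j →
    ∀ {v : Fin (2 ^ n) → ZMod 2}, v ∈ spanAbove n j →
      hammingNorm (row n i + row n j) ≤ hammingNorm (row n i + row n j + v)
  | 0, i, j, hij, _, _ => by
    have := j.isLt
    have : (i : ℕ) < j := hij
    omega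
  | n + 1, i, j, hij, v, hv => by
    rcases eq_lowIdx_or_eq_highIdx j with ⟨j, rfl⟩ | ⟨j, rfl⟩
    · obtain ⟨u, hu, w, rfl⟩ := exists_app2_of_mem_spanAbove_lowIdx hv
      rcases eq_lowIdx_or_eq_highIdx i with ⟨i, rfl⟩ | ⟨i, rfl⟩
      · have ih := hammingNorm_row_add_row_le (i := i) (j := j) hij hu
        have h := hammingNorm_mul_le_add (mul_one 1) (row n i + row n j + u) w
        simp only [one_mul] at h
        simp only [row_lowIdx, app2_add, hammingNorm_app2, add_zero, zero_add,
          hammingNorm_zero, ← add_assoc]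
        exact ih.trans h
      · have := j.isLt
        simp only [lowIdx, highIdx, Fin.mk_lt_mk] at hij
        omega
    · obtain ⟨u, hu, rfl⟩ := exists_app2_of_mem_spanAbove_highIdx hv
      rcases eq_lowIdx_or_eq_highIdx i with ⟨i, rfl⟩ | ⟨i, rfl⟩
      · have h := hammingNorm_mul_row_le (isUpMask_one_sub_row i) j hu
        simp only [row_lowIdx, row_highIdx, app2_add, hammingNorm_app2, zero_add, add_assoc]
        rw [hammingNorm_add_add_hammingNorm, hammingNorm_add_add_hammingNorm]
        omega
      · have ih := hammingNorm_row_add_row_le (i := i) (j := j)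
          (by simpa [highIdx] using hij) hu
        simp only [row_highIdx, app2_add, hammingNorm_app2]
        exact add_le_add ih ih

/-- For `N = 2^n` and `0 ≤ i < j < N`, every `x ∈ C^{(n)}(i, j)` satisfies
`w(x) ≥ w(g_i + g_j)`. -/
theorem stmt_13 (n i j : ℕ) (hi : i < 2 ^ n) (hj : j < 2 ^ n) (hij : i < j) :
    ∀ x ∈ twoCoset n ⟨i, hi⟩ ⟨j, hj⟩,
      hammingNorm (row n ⟨i, hi⟩ + row n ⟨j, hj⟩) ≤ hammingNorm x := by
  rintro _ ⟨v, hv, rfl⟩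
  exact hammingNorm_row_add_row_le hij hv
end

section
/- Let N = 2^n and 0 ≤ i, j < N. The number of coordinates at which the rows g_i and g_j of G_N are both equal to 1 is T_{i,j} = 2^{t_{i,j}}, where t_{i,j} := Σ_{k=0}^{n-1} b_k(i) b_k(j). Consequently, w(g_i + g_j) = w(g_i) + w(g_j) − 2^{t_{i,j}+1}. -/
/-- The index equivalence used in the recursive definition of `G`. -/
def kroneckerIndex (n : ℕ) : Fin 2 × Fin (2 ^ n) ≃ Fin (2 ^ (n + 1)) :=
  finProdFinEquiv.trans (finCongr (by ring))

theorem kroneckerIndex_val (n : ℕ) (p : Fin 2 × Fin (2 ^ n)) :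
    (kroneckerIndex n p : ℕ) = p.2 + 2 ^ n * p.1 := rfl

theorem row_succ_kroneckerIndex (n : ℕ) (p q : Fin 2 × Fin (2 ^ n)) :
    row (n + 1) (kroneckerIndex n p) (kroneckerIndex n q) = G2 p.1 q.1 * row n p.2 q.2 := by
  have h : G (n + 1) = Matrix.reindex (kroneckerIndex n) (kroneckerIndex n)
      (Matrix.kroneckerMap (· * ·) G2 (G n)) := rfl
  simp [row, h]

theorem bit_add_two_pow_mul_of_lt {n k : ℕ} (b a : ℕ) (hk : k < n) :
    bit (b + 2 ^ n * a) k = bit b k := by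
  obtain ⟨m, rfl⟩ := Nat.exists_eq_add_of_lt hk
  have h : 2 ^ (k + m + 1) * a = 2 ^ k * (2 * (2 ^ m * a)) := by ring
  rw [bit, bit, h, Nat.add_mul_div_left _ _ (by positivity), Nat.add_mul_mod_self_left]

theorem bit_add_two_pow_mul_self {n b a : ℕ} (hb : b < 2 ^ n) (ha : a < 2) :
    bit (b + 2 ^ n * a) n = a := by
  rw [bit, Nat.add_mul_div_left _ _ (by positivity), Nat.div_eq_of_lt hb, zero_add,
    Nat.mod_eq_of_lt ha]

theorem card_common_ones_G2 (a b : Fin 2) :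
    (Finset.univ.filter fun k => G2 a k = 1 ∧ G2 b k = 1).card = 2 ^ ((a : ℕ) * b) := by
  revert a b
  decide

theorem card_common_ones_row (n : ℕ) (i j : Fin (2 ^ n)) :
    (Finset.univ.filter fun k => row n i k = 1 ∧ row n j k = 1).card =
      2 ^ (∑ k ∈ Finset.range n, bit i k * bit j k) := by
  induction n with
  | zero =>
    have h (i k : Fin (2 ^ 0)) : row 0 i k = 1 := by
      rw [show k = i from Subsingleton.elim (α := Fin 1) k i]
      exact Matrix.one_apply_eq i
    simp [h]
  | succ n ih =>
    obtain ⟨⟨a, i⟩, rfl⟩ := (kroneckerIndex n).surjective i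
    obtain ⟨⟨b, j⟩, rfl⟩ := (kroneckerIndex n).surjective j
    have hmul : ∀ x y : ZMod 2, x * y = 1 ↔ x = 1 ∧ y = 1 := by decide
    have hbits : ∑ k ∈ Finset.range n,
        bit (kroneckerIndex n (a, i)) k * bit (kroneckerIndex n (b, j)) k =
          ∑ k ∈ Finset.range n, bit i k * bit j k := by
      refine Finset.sum_congr rfl fun k hk => ?_
      rw [Finset.mem_range] at hk
      simp only [kroneckerIndex_val, bit_add_two_pow_mul_of_lt _ _ hk]
    have hset : (Finset.univ.filter fun k => row (n + 1) (kroneckerIndex n (a, i)) k = 1 ∧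
        row (n + 1) (kroneckerIndex n (b, j)) k = 1) =
        ((Finset.univ.filter fun k => G2 a k = 1 ∧ G2 b k = 1) ×ˢ
          (Finset.univ.filter fun k => row n i k = 1 ∧ row n j k = 1)).map
            (kroneckerIndex n).toEmbedding := by
      ext k
      obtain ⟨q, rfl⟩ := (kroneckerIndex n).surjective k
      simp only [Finset.mem_filter, Finset.mem_univ, true_and, row_succ_kroneckerIndex, hmul,
        Finset.mem_map_equiv, Equiv.symm_apply_apply, Finset.mem_product]
      tauto
    rw [hset, Finset.card_map, Finset.card_product, card_common_ones_G2, ih,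
      Finset.sum_range_succ, hbits, kroneckerIndex_val, kroneckerIndex_val,
      bit_add_two_pow_mul_self i.isLt a.isLt, bit_add_two_pow_mul_self j.isLt b.isLt,
      pow_add, mul_comm]

theorem hammingNorm_add_add_two_mul_card_common_ones {ι : Type*} [Fintype ι] (x y : ι → ZMod 2) :
    hammingNorm (x + y) + 2 * (Finset.univ.filter fun k => x k = 1 ∧ y k = 1).card =
      hammingNorm x + hammingNorm y := by
  have h : ∀ a b : ZMod 2, (if a + b ≠ 0 then 1 else 0) + 2 * (if a = 1 ∧ b = 1 then 1 else 0) =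
      (if a ≠ 0 then 1 else 0) + (if b ≠ 0 then 1 else 0) := by decide
  simp only [hammingNorm, Finset.card_filter, Finset.mul_sum, ← Finset.sum_add_distrib]
  exact Finset.sum_congr rfl fun k _ => h (x k) (y k)

/-- For `N = 2^n` and `0 ≤ i, j < N`, the number of coordinates where the
rows `g_i` and `g_j` are both `1` is `T_{i,j} = 2^{t_{i,j}}` with
`t_{i,j} = Σ_{k=0}^{n-1} b_k(i) b_k(j)`; consequently
`w(g_i + g_j) = w(g_i) + w(g_j) - 2^{t_{i,j}+1}`. -/
theorem stmt_14 (n i j : ℕ) (hi : i < 2 ^ n) (hj : j < 2 ^ n) :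
    (Finset.univ.filter fun k => row n ⟨i, hi⟩ k = 1 ∧ row n ⟨j, hj⟩ k = 1).card =
      2 ^ (∑ k ∈ Finset.range n, bit i k * bit j k) ∧
    hammingNorm (row n ⟨i, hi⟩ + row n ⟨j, hj⟩) =
      hammingNorm (row n ⟨i, hi⟩) + hammingNorm (row n ⟨j, hj⟩) -
        2 ^ (∑ k ∈ Finset.range n, bit i k * bit j k + 1) := by
  have hcard := card_common_ones_row n ⟨i, hi⟩ ⟨j, hj⟩
  refine ⟨hcard, ?_⟩
  have hweight := hammingNorm_add_add_two_mul_card_common_ones (row n ⟨i, hi⟩) (row n ⟨j, hj⟩)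
  rw [hcard] at hweight
  rw [pow_succ', ← hweight, Nat.add_sub_cancel]
end

section
/- Let N = 2^n and 0 ≤ i < j < N, and let n_0 ∈ [0, n) be the largest index such that b_{n_0}(i) = 0 and b_{n_0}(j) = 1 (such an index exists since i < j). Then one of the following two statements holds: (1) there exists ℓ ∈ [0, n) with ℓ ≠ n_0 such that b_ℓ(i) ≤ b_ℓ(j) and f_ℓ(i) < f_ℓ(j); or (2) i = N/2 − 1 and j = N/2. -/
/-- `delBit n l k = Σ_{r=0}^{l-1} b_r(k) 2^r + Σ_{r=l+1}^{n-1} b_r(k) 2^{r-1}` is the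
integer obtained from `k < 2^n` by deleting the `l`-th bit of its binary representation. -/
def delBit (n l k : ℕ) : ℕ :=
  ∑ r ∈ Finset.range l, bit k r * 2 ^ r + ∑ r ∈ Finset.Ico (l + 1) n, bit k r * 2 ^ (r - 1)

theorem sum_bit_mul_two_pow (k m : ℕ) :
    ∑ r ∈ Finset.range m, bit k r * 2 ^ r = k % 2 ^ m := by
  induction m with
  | zero => simp [Nat.mod_one]
  | succ m ih => rw [Finset.sum_range_succ, ih, Nat.mod_pow_succ, bit, mul_comm]

theorem bit_add (k a r : ℕ) : bit k (a + r) = bit (k / 2 ^ a) r := by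
  rw [bit, bit, pow_add, Nat.div_div_eq_div_mul]

theorem bit_le_one (k r : ℕ) : bit k r ≤ 1 := by
  unfold bit; omega

theorem delBit_eq {n l k : ℕ} (hl : l < n) (hk : k < 2 ^ n) :
    delBit n l k = k % 2 ^ l + 2 ^ l * (k / 2 ^ (l + 1)) := by
  have hlt : k / 2 ^ (l + 1) < 2 ^ (n - (l + 1)) := by
    rw [Nat.div_lt_iff_lt_mul (by positivity), ← pow_add, Nat.sub_add_cancel hl]
    exact hk
  rw [delBit, sum_bit_mul_two_pow, Finset.sum_Ico_eq_sum_range,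
    ← Nat.mod_eq_of_lt hlt, ← sum_bit_mul_two_pow (k / 2 ^ (l + 1)), Finset.mul_sum]
  congr 1
  refine Finset.sum_congr rfl fun r _ => ?_
  rw [bit_add, show l + 1 + r - 1 = l + r by omega, pow_add]
  ring

theorem delBit_lt_of_div_lt {n l i j : ℕ} (hl : l < n) (hi : i < 2 ^ n) (hj : j < 2 ^ n)
    (h : i / 2 ^ (l + 1) < j / 2 ^ (l + 1)) : delBit n l i < delBit n l j := by
  rw [delBit_eq hl hi, delBit_eq hl hj]
  have hmod : i % 2 ^ l < 2 ^ l := Nat.mod_lt _ (by positivity)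
  have hmul := Nat.mul_le_mul_left (2 ^ l) (Nat.succ_le_of_lt h)
  rw [Nat.mul_succ] at hmul
  omega

theorem delBit_lt_of_div_eq {n l i j : ℕ} (hl : l < n) (hi : i < 2 ^ n) (hj : j < 2 ^ n)
    (hij : i < j) (h : i / 2 ^ l = j / 2 ^ l) : delBit n l i < delBit n l j := by
  rw [delBit_eq hl hi, delBit_eq hl hj, pow_succ, ← Nat.div_div_eq_div_mul,
    ← Nat.div_div_eq_div_mul, h]
  have hi' := Nat.mod_add_div i (2 ^ l)
  have hj' := Nat.mod_add_div j (2 ^ l)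
  rw [h] at hi'
  omega

theorem mod_two_pow_of_bit_eq_zero {k m : ℕ} (h : ∀ r < m, bit k r = 0) : k % 2 ^ m = 0 := by
  rw [← sum_bit_mul_two_pow]
  exact Finset.sum_eq_zero fun r hr => by rw [h r (Finset.mem_range.1 hr), zero_mul]

theorem mod_two_pow_of_bit_eq_one {k m : ℕ} (h : ∀ r < m, bit k r = 1) :
    k % 2 ^ m = 2 ^ m - 1 := by
  rw [← sum_bit_mul_two_pow, ← Nat.geomSum_eq le_rfl m |>.trans (Nat.div_one _)]
  exact Finset.sum_congr rfl fun r hr => by rw [h r (Finset.mem_range.1 hr), one_mul]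

theorem bit_pred_eq_div {n k : ℕ} (hn : 0 < n) (hk : k < 2 ^ n) :
    bit k (n - 1) = k / 2 ^ (n - 1) := by
  refine Nat.mod_eq_of_lt ?_
  rw [Nat.div_lt_iff_lt_mul (by positivity), ← pow_succ', Nat.sub_add_cancel hn]
  exact hk

/-- Let `N = 2^n`, `0 ≤ i < j < N`, and let `n_0 < n` be the largest index
with `b_{n_0}(i) = 0` and `b_{n_0}(j) = 1`. Then either (1) there exists `l < n`,
`l ≠ n_0`, with `b_l(i) ≤ b_l(j)` and `f_l(i) < f_l(j)`; or (2) `i = N/2 - 1` and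
`j = N/2`. -/
theorem stmt_15 (n i j : ℕ) (hi : i < 2 ^ n) (hj : j < 2 ^ n) (hij : i < j)
    (n0 : ℕ) (hn0 : n0 < n) (hbi : bit i n0 = 0) (hbj : bit j n0 = 1)
    (hmax : ∀ k, n0 < k → k < n → ¬(bit i k = 0 ∧ bit j k = 1)) :
    (∃ l < n, l ≠ n0 ∧ bit i l ≤ bit j l ∧ delBit n l i < delBit n l j) ∨
    (i = 2 ^ (n - 1) - 1 ∧ j = 2 ^ (n - 1)) := by
  have hn : 0 < n := by omega
  have hti := bit_pred_eq_div hn hi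
  have htj := bit_pred_eq_div hn hj
  by_cases htop : n0 = n - 1
  · subst htop
    rw [hbi] at hti
    rw [hbj] at htj
    by_cases hex : ∃ l < n - 1, bit i l ≤ bit j l
    · obtain ⟨l, hl, hle⟩ := hex
      refine .inl ⟨l, by omega, hl.ne, hle, delBit_lt_of_div_lt (by omega) hi hj ?_⟩
      refine lt_of_le_of_ne (Nat.div_le_div_right hij.le) fun heq => ?_
      have hsplit : n - 1 = l + 1 + (n - 1 - (l + 1)) := by omega
      rw [hsplit, bit_add] at hbi hbj
      rw [heq, hbj] at hbi
      exact one_ne_zero hbi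
    · push Not at hex
      have hbits : ∀ l < n - 1, bit i l = 1 ∧ bit j l = 0 := fun l hl => by
        have := hex l hl
        have := bit_le_one i l
        omega
      have hmi := mod_two_pow_of_bit_eq_one fun r hr => (hbits r hr).1
      have hmj := mod_two_pow_of_bit_eq_zero fun r hr => (hbits r hr).2
      have hdi := Nat.mod_add_div i (2 ^ (n - 1))
      have hdj := Nat.mod_add_div j (2 ^ (n - 1))
      rw [hmi, ← hti] at hdi
      rw [hmj, ← htj] at hdj
      right
      omega
  · have hle : i / 2 ^ (n - 1) ≤ j / 2 ^ (n - 1) := Nat.div_le_div_right hij.le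
    have heq : i / 2 ^ (n - 1) = j / 2 ^ (n - 1) := by
      have := hmax (n - 1) (by omega) (by omega)
      have := bit_le_one j (n - 1)
      omega
    exact .inl ⟨n - 1, by omega, Ne.symm htop, by omega,
      delBit_lt_of_div_eq (by omega) hi hj hij heq⟩
end
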